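/- Let I and P be disjoint finite nonempty index sets, x : I ∪ P → ℝ, d ≥ 1, v : I ∪ P → ℝ^d with ‖v_j‖₂ ≤ C_V for all j, and define Z_I, Z_P, y, y' as the softmax attention outputs before and after padding (y = (1/Z_I)·Σ_{i∈I} e^{x_i} v_i, y' = (1/(Z_I+Z_P))·(Σ_{i∈I} e^{x_i} v_i + Σ_{p∈P} e^{x_p} v_p) with Z_I = Σ_{i∈I} e^{x_i}, Z_P = Σ_{p∈P} e^{x_p}). Suppose there exists j ∈ I such that Δ := x_j − max_{p∈P} x_p > 0, let m = |P|, and let ε ∈ (0, 2C_V). If m ≤ e^Δ · ε/(2C_V − ε), then ‖y' − y‖₂ ≤ ε. -/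

import Mathlib

open Finset

/-- A combination of vectors of norm at most `C` with weights `exp (x i)` has norm at most `C`
times the total weight. -/
theorem norm_sum_exp_smul_le {ι E : Type*} [SeminormedAddCommGroup E] [NormedSpace ℝ E]
    (s : Finset ι) (x : ι → ℝ) (v : ι → E) (C : ℝ) (hv : ∀ i ∈ s, ‖v i‖ ≤ C) :
    ‖∑ i ∈ s, Real.exp (x i) • v i‖ ≤ (∑ i ∈ s, Real.exp (x i)) * C := by
  rw [Finset.sum_mul]
  refine norm_sum_le_of_le _ fun i hi => ?_
  rw [norm_smul, Real.norm_of_nonneg (Real.exp_pos _).le]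
  exact mul_le_mul_of_nonneg_left (hv i hi) (Real.exp_pos _).le

/-- Merging extra mass `b` with weighted sum `u` into a weighted average `a⁻¹ • w`. -/
theorem norm_merged_average_sub_le {E : Type*} [SeminormedAddCommGroup E] [NormedSpace ℝ E]
    {a b C : ℝ} (ha : 0 < a) (hb : 0 ≤ b) {w u : E} (hw : ‖w‖ ≤ a * C) (hu : ‖u‖ ≤ b * C) :
    ‖(1 / (a + b)) • (w + u) - (1 / a) • w‖ ≤ 2 * C * b / (a + b) := by
  have hab : 0 < a + b := by positivity
  have hdecomp : (1 / (a + b)) • (w + u) - (1 / a) • w =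
      (1 / (a + b)) • (u - (b / a) • w) := by
    match_scalars <;> field_simp
    ring
  have hscaled : ‖(b / a) • w‖ ≤ b * C := by
    rw [norm_smul, Real.norm_of_nonneg (by positivity)]
    calc b / a * ‖w‖ ≤ b / a * (a * C) := by gcongr
      _ = b * C := by field_simp
  rw [hdecomp, norm_smul, Real.norm_of_nonneg (by positivity), one_div_mul_eq_div]
  gcongr
  linarith [norm_sub_le u ((b / a) • w)]

/-- **Sufficient condition for attention stability under padding.** If there is a dominant
informative token `j ∈ I` with logit gap `Δ = x_j − max_{p∈P} x_p > 0`, `ε ∈ (0, 2C_V)`, and the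
number of padding tokens satisfies `m ≤ e^Δ · ε/(2C_V − ε)`, then `‖y' − y‖₂ ≤ ε`. -/
theorem attention_padding_sufficient {ι : Type*} [DecidableEq ι]
    (I P : Finset ι) (hdisj : Disjoint I P) (hI : I.Nonempty) (hP : P.Nonempty)
    (x : ι → ℝ) (d : ℕ) (hd : 1 ≤ d)
    (v : ι → EuclideanSpace ℝ (Fin d)) (CV : ℝ)
    (hv : ∀ j ∈ I ∪ P, ‖v j‖ ≤ CV)
    (ZI ZP : ℝ)
    (hZI : ZI = ∑ i ∈ I, Real.exp (x i))
    (hZP : ZP = ∑ p ∈ P, Real.exp (x p))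
    (y y' : EuclideanSpace ℝ (Fin d))
    (hy : y = (1 / ZI) • ∑ i ∈ I, Real.exp (x i) • v i)
    (hy' : y' = (1 / (ZI + ZP)) •
      ((∑ i ∈ I, Real.exp (x i) • v i) + ∑ p ∈ P, Real.exp (x p) • v p))
    (j : ι) (hj : j ∈ I) (Δ : ℝ) (hΔ : Δ = x j - P.sup' hP x) (hΔpos : 0 < Δ)
    (ε : ℝ) (hε : ε ∈ Set.Ioo 0 (2 * CV))
    (hm : (P.card : ℝ) ≤ Real.exp Δ * ε / (2 * CV - ε)) :
    ‖y' - y‖ ≤ ε := by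
  obtain ⟨hε0, hε1⟩ := hε
  have hZIge : Real.exp (x j) ≤ ZI := by
    rw [hZI]
    exact Finset.single_le_sum (f := fun i => Real.exp (x i))
      (fun i _ => (Real.exp_pos _).le) hj
  have hZIpos : 0 < ZI := (Real.exp_pos _).trans_le hZIge
  have hZP0 : 0 ≤ ZP := hZP ▸ Finset.sum_nonneg fun p _ => (Real.exp_pos _).le
  have hZPle : ZP ≤ P.card * Real.exp (P.sup' hP x) := by
    rw [hZP, ← nsmul_eq_mul]
    exact Finset.sum_le_card_nsmul _ _ _ fun p hp =>
      Real.exp_le_exp.mpr (Finset.le_sup' x hp)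
  have hmass : (2 * CV - ε) * ZP ≤ ε * ZI := by
    have hgap : 0 < 2 * CV - ε := by linarith
    rw [le_div_iff₀ hgap] at hm
    calc (2 * CV - ε) * ZP
        ≤ (2 * CV - ε) * (P.card * Real.exp (P.sup' hP x)) := by gcongr
      _ = P.card * (2 * CV - ε) * Real.exp (P.sup' hP x) := by ring
      _ ≤ Real.exp Δ * ε * Real.exp (P.sup' hP x) := by gcongr
      _ = ε * Real.exp (x j) := by
          rw [mul_right_comm, ← Real.exp_add, hΔ, sub_add_cancel, mul_comm]
      _ ≤ ε * ZI := by gcongr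
  have hSI := norm_sum_exp_smul_le I x v CV fun i hi => hv i (Finset.mem_union_left P hi)
  have hSP := norm_sum_exp_smul_le P x v CV fun p hp => hv p (Finset.mem_union_right I hp)
  rw [← hZI] at hSI
  rw [← hZP] at hSP
  rw [hy, hy']
  refine (norm_merged_average_sub_le hZIpos hZP0 hSI hSP).trans ?_
  rw [div_le_iff₀ (by positivity)]
  linarith
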